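/- Let A be an equational Artinian L-structure and n a natural number. Then every algebraic set Y ⊆ Aⁿ can be written as a finite intersection Y = Y₁ ∩ ⋯ ∩ Yₘ, where each Yᵢ is a large algebraic set, i.e., an algebraic set whose radical Rad(Yᵢ) is an irreducible closed set in the radical topology with respect to A on At_L(x₁,…,xₙ). -/

import Mathlib

open FirstOrder

/-- The solution set in `A` of a system `S` of equations in `n` variables. -/
def VSet (L : FirstOrder.Language) (A : Type*) [L.Structure A] {n : ℕ}
    (S : Set (L.Term (Fin n) × L.Term (Fin n))) : Set (Fin n → A) :=
  { a | ∀ pq ∈ S, pq.1.realize a = pq.2.realize a }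

/-- A subset of `Aⁿ` is an algebraic set if it is the solution set of some system. -/
def IsAlgebraicSet (L : FirstOrder.Language) (A : Type*) [L.Structure A] {n : ℕ}
    (Y : Set (Fin n → A)) : Prop :=
  ∃ S, Y = VSet L A S

/-- The radical of a subset `E ⊆ Aⁿ`. -/
def Rad (L : FirstOrder.Language) (A : Type*) [L.Structure A] {n : ℕ}
    (E : Set (Fin n → A)) : Set (L.Term (Fin n) × L.Term (Fin n)) :=
  { pq | ∀ a ∈ E, pq.1.realize a = pq.2.realize a }

/-- An `A`-radical ideal of the term algebra. -/
def IsRadicalIdeal (L : FirstOrder.Language) (A : Type*) [L.Structure A] {n : ℕ}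
    (R : Set (L.Term (Fin n) × L.Term (Fin n))) : Prop :=
  ∃ E : Set (Fin n → A), R = Rad L A E

/-- `A` is equational Artinian: every ascending chain of algebraic sets stabilizes. -/
def EquationalArtinian (L : FirstOrder.Language) (A : Type*) [L.Structure A] : Prop :=
  ∀ (n : ℕ) (Y : ℕ → Set (Fin n → A)),
    (∀ i, IsAlgebraicSet L A (Y i)) → (∀ i, Y i ⊆ Y (i + 1)) →
    ∃ N, ∀ m, N ≤ m → Y m = Y N

/-- The radical topology on atomic formulas: closed sets are arbitrary intersections of
finite unions of `A`-radical ideals. -/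
def radicalTopology (L : FirstOrder.Language) (A : Type*) [L.Structure A] (n : ℕ) :
    TopologicalSpace (L.Term (Fin n) × L.Term (Fin n)) :=
  TopologicalSpace.generateFrom { U | IsRadicalIdeal L A Uᶜ }

/-- The Zariski topology on `Aⁿ`: closed sets are arbitrary intersections of
finite unions of algebraic sets. -/
def zariskiTopology (L : FirstOrder.Language) (A : Type*) [L.Structure A] (n : ℕ) :
    TopologicalSpace (Fin n → A) :=
  TopologicalSpace.generateFrom { U | IsAlgebraicSet L A Uᶜ }

/-- An irreducible closed set of a topology `t`: closed and not the union of two proper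
closed subsets. -/
def IsIrreducibleClosedIn {X : Type*} (t : TopologicalSpace X) (C : Set X) : Prop :=
  @IsClosed _ t C ∧ ¬ ∃ C₁ C₂ : Set X,
    @IsClosed _ t C₁ ∧ @IsClosed _ t C₂ ∧ C₁ ⊂ C ∧ C₂ ⊂ C ∧ C = C₁ ∪ C₂
lemma TopologicalSpace.exists_finite_sInter_subset_compl_of_isClosed {X : Type*}
    {s : Set (Set X)} {C : Set X} (hC : @IsClosed X (generateFrom s) C) {x : X} (hx : x ∉ C) :
    ∃ F : Set (Set X), F.Finite ∧ F ⊆ s ∧ x ∈ ⋂₀ F ∧ ⋂₀ F ⊆ Cᶜ := by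
  let : TopologicalSpace X := generateFrom s
  obtain ⟨_, ⟨F, ⟨hfin, hFs⟩, rfl⟩, hxF, hFC⟩ :=
    (isTopologicalBasis_of_subbasis (s := s) rfl).exists_subset_of_mem_open
      (show x ∈ Cᶜ from hx) hC.isOpen_compl
  exact ⟨F, hfin, hFs, hxF, hFC⟩

section Radical

variable {L : FirstOrder.Language} {A : Type*} [L.Structure A] {n : ℕ}

lemma subset_VSet_iff_subset_Rad {S : Set (L.Term (Fin n) × L.Term (Fin n))}
    {E : Set (Fin n → A)} : E ⊆ VSet L A S ↔ S ⊆ Rad L A E :=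
  ⟨fun h pq hpq _ ha => h ha pq hpq, fun h a ha _ hpq => h hpq a ha⟩

lemma IsAlgebraicSet.VSet_Rad {Y : Set (Fin n → A)} (hY : IsAlgebraicSet L A Y) :
    VSet L A (Rad L A Y) = Y := by
  obtain ⟨S, rfl⟩ := hY
  refine Set.Subset.antisymm (fun a ha pq hpq => ha pq ?_) ?_
  · exact subset_VSet_iff_subset_Rad.1 subset_rfl hpq
  · exact subset_VSet_iff_subset_Rad.2 subset_rfl

lemma IsRadicalIdeal.Rad_VSet {R : Set (L.Term (Fin n) × L.Term (Fin n))}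
    (hR : IsRadicalIdeal L A R) : Rad L A (VSet L A R) = R := by
  obtain ⟨E, rfl⟩ := hR
  refine Set.Subset.antisymm (fun pq hpq a ha => hpq a ?_) ?_
  · exact subset_VSet_iff_subset_Rad.2 subset_rfl ha
  · exact subset_VSet_iff_subset_Rad.1 subset_rfl

lemma IsRadicalIdeal.inter {R R' : Set (L.Term (Fin n) × L.Term (Fin n))}
    (hR : IsRadicalIdeal L A R) (hR' : IsRadicalIdeal L A R') :
    IsRadicalIdeal L A (R ∩ R') := by
  obtain ⟨E, rfl⟩ := hR
  obtain ⟨E', rfl⟩ := hR'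
  refine ⟨E ∪ E', Set.ext fun pq => ?_⟩
  simp only [Rad, Set.mem_inter_iff, Set.mem_ofPred_eq, Set.mem_union, or_imp, forall_and]

lemma IsRadicalIdeal.isClosed {R : Set (L.Term (Fin n) × L.Term (Fin n))}
    (hR : IsRadicalIdeal L A R) : @IsClosed _ (radicalTopology L A n) R :=
  let := radicalTopology L A n
  ⟨TopologicalSpace.isOpen_generateFrom_of_mem (by simpa using hR)⟩

lemma EquationalArtinian.wellFoundedGT (hA : EquationalArtinian L A) (n : ℕ) :
    WellFoundedGT {Y : Set (Fin n → A) // IsAlgebraicSet L A Y} := by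
  refine wellFoundedGT_iff_monotone_chain_condition.2 fun f => ?_
  obtain ⟨N, hN⟩ := hA n (fun i => (f i).1) (fun i => (f i).2)
    (fun i => f.monotone (Nat.le_succ i))
  exact ⟨N, fun m hm => Subtype.ext (hN m hm).symm⟩

/-- An algebraic set whose radical is reducible is a finite intersection of strictly larger
algebraic sets. -/
lemma IsAlgebraicSet.exists_finite_sInter_of_not_irreducible {Y : Set (Fin n → A)}
    (hY : IsAlgebraicSet L A Y)
    (hirr : ¬ IsIrreducibleClosedIn (radicalTopology L A n) (Rad L A Y)) :
    ∃ F : Set (Set (Fin n → A)), F.Finite ∧ (∀ Z ∈ F, IsAlgebraicSet L A Z ∧ Y ⊂ Z) ∧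
      Y = ⋂₀ F := by
  have hRad : IsRadicalIdeal L A (Rad L A Y) := ⟨Y, rfl⟩
  obtain ⟨C₁, C₂, hC₁, hC₂, hlt₁, hlt₂, hC⟩ := not_not.1 fun h => hirr ⟨hRad.isClosed, h⟩
  obtain ⟨x, hx, hx₁⟩ := Set.exists_of_ssubset hlt₁
  obtain ⟨y, hy, hy₂⟩ := Set.exists_of_ssubset hlt₂
  obtain ⟨F₁, hfin₁, hF₁, hxF, hFC₁⟩ :=
    TopologicalSpace.exists_finite_sInter_subset_compl_of_isClosed hC₁ hx₁
  obtain ⟨F₂, hfin₂, hF₂, hyF, hFC₂⟩ :=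
    TopologicalSpace.exists_finite_sInter_subset_compl_of_isClosed hC₂ hy₂
  have hsub (U : Set (L.Term (Fin n) × L.Term (Fin n))) : Y ⊆ VSet L A (Rad L A Y ∩ Uᶜ) :=
    subset_VSet_iff_subset_Rad.2 Set.inter_subset_left
  have hssub {U : Set (L.Term (Fin n) × L.Term (Fin n))} (hU : IsRadicalIdeal L A Uᶜ)
      {z : L.Term (Fin n) × L.Term (Fin n)} (hz : z ∈ Rad L A Y) (hzU : z ∈ U) :
      Y ⊂ VSet L A (Rad L A Y ∩ Uᶜ) := by
    refine (hsub U).ssubset_of_ne fun h => ?_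
    have hRadU := (hRad.inter hU).Rad_VSet
    rw [← h] at hRadU
    exact (hRadU.subset hz).2 hzU
  refine ⟨(fun U => VSet L A (Rad L A Y ∩ Uᶜ)) '' (F₁ ∪ F₂), (hfin₁.union hfin₂).image _,
    ?_, Set.Subset.antisymm ?_ fun a ha => ?_⟩
  · rintro _ ⟨U, hU | hU, rfl⟩
    · exact ⟨⟨_, rfl⟩, hssub (hF₁ hU) hx (hxF U hU)⟩
    · exact ⟨⟨_, rfl⟩, hssub (hF₂ hU) hy (hyF U hU)⟩
  · rintro a ha _ ⟨U, -, rfl⟩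
    exact hsub U ha
  · rw [← hY.VSet_Rad]
    intro pq hpq
    obtain ⟨U, hU, hpqU⟩ : ∃ U ∈ F₁ ∪ F₂, pq ∉ U := by
      by_contra! h
      rcases hC.subset hpq with h₁ | h₂
      · exact hFC₁ (fun U hU => h U (Or.inl hU)) h₁
      · exact hFC₂ (fun U hU => h U (Or.inr hU)) h₂
    exact ha _ ⟨U, hU, rfl⟩ pq ⟨hpq, hpqU⟩

lemma EquationalArtinian.exists_finite_sInter_large (hA : EquationalArtinian L A)
    {Y : Set (Fin n → A)} (hY : IsAlgebraicSet L A Y) :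
    ∃ F : Set (Set (Fin n → A)), F.Finite ∧ (∀ Z ∈ F, IsAlgebraicSet L A Z ∧
      IsIrreducibleClosedIn (radicalTopology L A n) (Rad L A Z)) ∧ Y = ⋂₀ F := by
  have := hA.wellFoundedGT n
  lift Y to {Y : Set (Fin n → A) // IsAlgebraicSet L A Y} using hY
  induction Y using WellFoundedGT.induction with
  | ind Y ih =>
    by_cases hirr : IsIrreducibleClosedIn (radicalTopology L A n) (Rad L A Y.1)
    · exact ⟨{Y.1}, Set.finite_singleton _, by simpa using ⟨Y.2, hirr⟩, by simp⟩
    obtain ⟨F, hfin, hF, hYF⟩ := Y.2.exists_finite_sInter_of_not_irreducible hirr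
    choose G hGfin hG hGZ using fun Z : F => ih ⟨Z.1, (hF Z.1 Z.2).1⟩ (hF Z.1 Z.2).2
    have := hfin.to_subtype
    refine ⟨⋃ Z, G Z, Set.finite_iUnion hGfin, fun W hW => ?_, ?_⟩
    · obtain ⟨Z, hZ⟩ := Set.mem_iUnion.1 hW
      exact hG Z W hZ
    · rw [Set.sInter_iUnion, hYF, Set.sInter_eq_iInter]
      exact Set.iInter_congr hGZ

end Radical

/-- over an equational Artinian `A`, every algebraic set is a finite
intersection of large algebraic sets (algebraic sets whose radical is an irreducible
closed set in the radical topology). -/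
theorem algebraicSet_eq_finite_inter_of_large
    {L : FirstOrder.Language} (A : Type*) [L.Structure A]
    (hL : ∀ k, IsEmpty (L.Relations k))
    (hA : EquationalArtinian L A) (n : ℕ)
    (Y : Set (Fin n → A)) (hY : IsAlgebraicSet L A Y) :
    ∃ (m : ℕ) (Z : Fin m → Set (Fin n → A)),
      (∀ i, IsAlgebraicSet L A (Z i)) ∧
      (∀ i, IsIrreducibleClosedIn (radicalTopology L A n) (Rad L A (Z i))) ∧
      Y = ⋂ i, Z i := by
  obtain ⟨F, hfin, hF, rfl⟩ := hA.exists_finite_sInter_large hY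
  have := hfin.to_subtype
  obtain ⟨m, ⟨e⟩⟩ := Finite.exists_equiv_fin F
  refine ⟨m, fun i => (e.symm i).1, fun i => (hF _ (e.symm i).2).1,
    fun i => (hF _ (e.symm i).2).2, ?_⟩
  rw [Set.sInter_eq_iInter]
  exact (e.symm.surjective.iInter_comp (fun Z : F => Z.1)).symm
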